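/- arXiv:1911.05977 — 10 statements merged into one kernel-verified Lean document; each statement's English description precedes it below -/
import Mathlib

section
/- Let τ be a non-discrete Hausdorff shift-continuous topology on C_Z^0. Then for every integer n, the subspace topology induced by τ on C_Z^0[n] is not discrete (equivalently, 0 is not an isolated point of the subspace C_Z^0[n]). -/
/-- The underlying set of the extended bicyclic semigroup: `ℤ × ℤ`. -/
abbrev CZ : Type := ℤ × ℤ

/-- Multiplication of the extended bicyclic semigroup `C_Z`. -/
def CZmul (p q : CZ) : CZ :=
  if p.2 < q.1 then (p.1 - p.2 + q.1, q.2)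
  else if p.2 = q.1 then (p.1, q.2)
  else (p.1, q.2 + p.2 - q.1)

/-- `C_Z` with an adjoined zero; `none` is the zero element. -/
abbrev CZ0 : Type := Option CZ

/-- Multiplication of `C_Z^0`; `none` is a zero element. -/
def CZ0mul : CZ0 → CZ0 → CZ0
  | some p, some q => some (CZmul p q)
  | _, _ => none

/-- Natural partial order on `C_Z`: `(a,b) ≼ (x,y)` iff `a - b = x - y` and `x ≤ a`. -/
def CZle (p q : CZ) : Prop := p.1 - p.2 = q.1 - q.2 ∧ q.1 ≤ p.1

/-- The upper set `↑≼(a,b)` in `C_Z`. -/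
def upSet (p : CZ) : Set CZ := {q | CZle p q}

/-- Natural partial order on `C_Z^0`: zero is below everything. -/
def CZ0le : CZ0 → CZ0 → Prop
  | none, _ => True
  | some _, none => False
  | some p, some q => CZle p q

/-- A topology on `C_Z^0` is shift-continuous if all left and right shifts are continuous. -/
def ShiftCont (t : TopologicalSpace CZ0) : Prop :=
  ∀ s : CZ0, @Continuous _ _ t t (fun u => CZ0mul s u) ∧ @Continuous _ _ t t (fun u => CZ0mul u s)

/-- The subsemigroup `C_Z[n]`. -/
def CZn (n : ℤ) : Set CZ := {p | n ≤ p.1 ∧ n ≤ p.2}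

/-- The subsemigroup `C_Z^0[n] = C_Z[n] ∪ {0}`. -/
def CZ0n (n : ℤ) : Set CZ0 := insert none (Option.some '' CZn n)

namespace ShiftCont

variable {t : TopologicalSpace CZ0}

/-- Zero together with the elements of first coordinate at least `e` is the fixed point set of left
multiplication by the idempotent `(e, e)`, so its complement is open. -/
theorem isOpen_fst_lt (h2 : T2Space CZ0) (hsh : ShiftCont t) (e : ℤ) :
    IsOpen (some '' {p : CZ | p.1 < e}) := by
  have h : IsOpen {x : CZ0 | CZ0mul (some (e, e)) x ≠ x} :=
    isOpen_ne_fun (hsh (some (e, e))).1 continuous_id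
  convert h using 1
  ext (_ | ⟨c, d⟩)
  · simp [CZ0mul]
  · simp only [CZ0mul, CZmul, Set.mem_image, Set.mem_ofPred_eq, Option.some.injEq, exists_eq_right]
    split_ifs <;> simp [Prod.ext_iff] <;> omega

/-- The analogue of `ShiftCont.isOpen_fst_lt` for right multiplication. -/
theorem isOpen_snd_lt (h2 : T2Space CZ0) (hsh : ShiftCont t) (e : ℤ) :
    IsOpen (some '' {p : CZ | p.2 < e}) := by
  have h : IsOpen {x : CZ0 | CZ0mul x (some (e, e)) ≠ x} :=
    isOpen_ne_fun (hsh (some (e, e))).2 continuous_id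
  convert h using 1
  ext (_ | ⟨c, d⟩)
  · simp [CZ0mul]
  · simp only [CZ0mul, CZmul, Set.mem_image, Set.mem_ofPred_eq, Option.some.injEq, exists_eq_right]
    split_ifs <;> simp [Prod.ext_iff] <;> omega

/-- Nonzero elements are isolated in every Hausdorff shift-continuous topology on `C_Z^0`. -/
theorem isOpen_singleton_some (h2 : T2Space CZ0) (hsh : ShiftCont t) (p : CZ) :
    IsOpen {(some p : CZ0)} := by
  obtain ⟨a, b⟩ := p
  have hfst := isOpen_fst_lt h2 hsh (a + 1)
  have hsnd := isOpen_snd_lt h2 hsh (b + 1)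
  have hleft := hsnd.preimage (hsh (some (a, a))).1
  have hright := hfst.preimage (hsh (some (b, b))).2
  have hcol : IsOpen {x : CZ0 | CZ0mul (some (a - 1, a - 1)) x ≠ some (a - 1, b - 1)} :=
    isOpen_ne_fun (hsh (some (a - 1, a - 1))).1 continuous_const
  convert (((hfst.inter hsnd).inter hleft).inter hright).inter hcol using 1
  ext (_ | ⟨c, d⟩)
  · simp
  · simp only [CZ0mul, CZmul, Set.mem_image, Set.mem_ofPred_eq, Option.some.injEq, exists_eq_right,
      Set.mem_inter_iff, Set.mem_preimage, Set.mem_singleton_iff, ne_eq]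
    split_ifs <;> simp only [Prod.mk.injEq] <;> grind only

/-- If `0` is isolated in `C_Z^0[n]`, then it is isolated in `C_Z^0`: the two-sided multiplication
by `(n, n)` maps `C_Z` into `C_Z[n]`. -/
theorem isOpen_singleton_none (hsh : ShiftCont t) {n : ℤ} {V : Set CZ0} (hV : IsOpen V)
    (hVn : V ∩ CZ0n n = {none}) : IsOpen {(none : CZ0)} := by
  have h := hV.preimage ((hsh (some (n, n))).1.comp (hsh (some (n, n))).2)
  convert h using 1
  have h0 : none ∈ V := (hVn.symm ▸ rfl : none ∈ V ∩ CZ0n n).1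
  ext (_ | ⟨c, d⟩)
  · simpa [CZ0mul] using h0
  · simp only [Set.mem_singleton_iff, reduceCtorEq, Set.mem_preimage, Function.comp_apply, CZ0mul,
      false_iff]
    intro hm
    have hmem : some (CZmul (n, n) (CZmul (c, d) (n, n))) ∈ CZ0n n := by
      refine Or.inr ⟨_, ?_, rfl⟩
      simp only [CZmul, CZn, Set.mem_ofPred_eq]
      split_ifs <;> simp only at * <;> omega
    have := hVn.subset ⟨hm, hmem⟩
    simp at this

end ShiftCont

theorem stmt2 (t : TopologicalSpace CZ0) (h2 : @T2Space CZ0 t) (hnd : t ≠ ⊥)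
    (hsh : ShiftCont t) (n : ℤ) :
    TopologicalSpace.induced ((↑) : (CZ0n n) → CZ0) t ≠ ⊥ := by
  intro hdisc
  have h0 : @IsOpen _ (TopologicalSpace.induced ((↑) : CZ0n n → CZ0) t)
      {(⟨none, Or.inl rfl⟩ : CZ0n n)} := by
    rw [hdisc]
    trivial
  obtain ⟨V, hV, hVeq⟩ := isOpen_induced_iff.1 h0
  have hVn : V ∩ CZ0n n = {none} := by
    rw [Set.inter_comm, ← Subtype.image_preimage_coe, hVeq, Set.image_singleton]
  have hdt : DiscreteTopology CZ0 := discreteTopology_iff_isOpen_singleton.2 fun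
    | none => hsh.isOpen_singleton_none hV hVn
    | some p => hsh.isOpen_singleton_some h2 p
  exact hnd hdt.eq_bot
end

section
/- Let (a,b),(c,d),(e,f) ∈ C_Z satisfy (a,b)·(c,d) = (e,f) and b ≤ c. Then the element (a−b+c, c) satisfies (a−b+c, c) ≼ (a,b), and for every (x,y) ∈ C_Z one has (x,y)·(c,d) = (e,f) if and only if (a−b+c, c) ≼ (x,y); in particular the solution set of X·(c,d) = (e,f) in C_Z is exactly ↑≼(a−b+c, c), with minimum element (a−b+c, c). -/
theorem stmt3 (a b c d e f : ℤ) (h : CZmul (a, b) (c, d) = (e, f)) (hbc : b ≤ c) :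
    CZle (a - b + c, c) (a, b) ∧
    (∀ xy : CZ, CZmul xy (c, d) = (e, f) ↔ CZle (a - b + c, c) xy) ∧
    {xy : CZ | CZmul xy (c, d) = (e, f)} = upSet (a - b + c, c) := by
  have key : ∀ xy : CZ, CZmul xy (c, d) = (e, f) ↔ CZle (a - b + c, c) xy := by
    rintro ⟨x, y⟩
    simp only [CZmul, CZle] at h ⊢
    split_ifs at h ⊢ <;> simp only [Prod.mk.injEq] at h ⊢ <;> omega
  refine ⟨?_, key, Set.ext key⟩
  simp only [CZle]
  omega
end

section
/- Let (a,b),(c,d),(e,f) ∈ C_Z satisfy (a,b)·(c,d) = (e,f) and b ≥ c. Then the element (b, d−c+b) satisfies (b, d−c+b) ≼ (c,d), and for every (x,y) ∈ C_Z one has (a,b)·(x,y) = (e,f) if and only if (b, d−c+b) ≼ (x,y); in particular the solution set of (a,b)·X = (e,f) in C_Z is exactly ↑≼(b, d−c+b), with minimum element (b, d−c+b). -/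
/-- When `x ≤ b`, the product `(a, b) · (x, y)` is `(a, y + b - x)`. -/
theorem CZmul_of_le (a : ℤ) {b x : ℤ} (y : ℤ) (hx : x ≤ b) :
    CZmul (a, b) (x, y) = (a, y + b - x) := by
  unfold CZmul
  split_ifs with h₁ h₂
  · exact absurd h₁ (not_lt.mpr hx)
  · have hbx : b = x := h₂
    simp [hbx]
  · rfl

/-- When `b < x`, the product `(a, b) · (x, y)` is `(a - b + x, y)`. -/
theorem CZmul_of_lt (a : ℤ) {b x : ℤ} (y : ℤ) (hx : b < x) :
    CZmul (a, b) (x, y) = (a - b + x, y) :=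
  if_pos hx

theorem stmt4 (a b c d e f : ℤ) (h : CZmul (a, b) (c, d) = (e, f)) (hbc : c ≤ b) :
    CZle (b, d - c + b) (c, d) ∧
    (∀ xy : CZ, CZmul (a, b) xy = (e, f) ↔ CZle (b, d - c + b) xy) ∧
    {xy : CZ | CZmul (a, b) xy = (e, f)} = upSet (b, d - c + b) := by
  have solution_iff (xy : CZ) :
      CZmul (a, b) xy = (e, f) ↔ CZle (b, d - c + b) xy := by
    obtain ⟨x, y⟩ := xy
    rw [← h, CZmul_of_le a d hbc]
    rcases le_or_gt x b with hx | hx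
    · rw [CZmul_of_le a y hx]
      simp only [CZle, Prod.mk.injEq, true_and]
      omega
    · rw [CZmul_of_lt a y hx]
      simp only [CZle, Prod.mk.injEq]
      omega
  exact ⟨(solution_iff (c, d)).mp h, solution_iff, Set.ext solution_iff⟩
end

section
/- Let τ be a non-discrete Hausdorff shift-continuous topology on C_Z^0. Then the natural partial order ≼ is closed on (C_Z^0, τ), i.e. the set {(s,t) ∈ C_Z^0 × C_Z^0 : s ≼ t} is a closed subset of the product space (C_Z^0, τ) × (C_Z^0, τ). -/
theorem CZmul_eq_max (p q : CZ) :
    CZmul p q = (p.1 + max 0 (q.1 - p.2), q.2 + max 0 (p.2 - q.1)) := by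
  unfold CZmul
  split_ifs <;> ext <;> dsimp only <;> omega

/-- The equation `(a,a) · x = (a,b)` describes the upper set of `(a,b)`. -/
theorem CZ0mul_idem_eq_iff (a b : ℤ) (x : CZ0) :
    CZ0mul (some (a, a)) x = some (a, b) ↔ CZ0le (some (a, b)) x := by
  rcases x with _ | ⟨c, d⟩
  · simp [CZ0mul, CZ0le]
  · simp only [CZ0mul, CZ0le, CZmul_eq_max, CZle, Option.some.injEq, Prod.mk.injEq]
    omega

theorem CZ0mul_idem_left_ne_iff (a : ℤ) (x : CZ0) :
    CZ0mul (some (a, a)) x ≠ x ↔ ∃ c d : ℤ, x = some (c, d) ∧ c < a := by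
  rcases x with _ | ⟨c, d⟩
  · simp [CZ0mul]
  · simp only [CZ0mul, CZmul_eq_max, Option.some.injEq, ne_eq, Prod.mk.injEq]
    constructor
    · intro h
      exact ⟨c, d, ⟨rfl, rfl⟩, by omega⟩
    · rintro ⟨_, _, ⟨rfl, rfl⟩, h⟩
      omega

theorem CZ0mul_idem_right_ne_iff (b : ℤ) (x : CZ0) :
    CZ0mul x (some (b, b)) ≠ x ↔ ∃ c d : ℤ, x = some (c, d) ∧ d < b := by
  rcases x with _ | ⟨c, d⟩
  · simp [CZ0mul]
  · simp only [CZ0mul, CZmul_eq_max, Option.some.injEq, ne_eq, Prod.mk.injEq]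
    constructor
    · intro h
      exact ⟨c, d, ⟨rfl, rfl⟩, by omega⟩
    · rintro ⟨_, _, ⟨rfl, rfl⟩, h⟩
      omega

section ShiftContinuous

variable [t : TopologicalSpace CZ0] [T2Space CZ0]

theorem ShiftCont.isClosed_upper (hsh : ShiftCont t) (p : CZ) :
    IsClosed {x : CZ0 | CZ0le (some p) x} := by
  obtain ⟨a, b⟩ := p
  simp only [← CZ0mul_idem_eq_iff]
  exact isClosed_eq (hsh _).1 continuous_const

theorem ShiftCont.isOpen_fst_lt_s5 (hsh : ShiftCont t) (a : ℤ) :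
    IsOpen {x : CZ0 | ∃ c d : ℤ, x = some (c, d) ∧ c < a} := by
  simp only [← CZ0mul_idem_left_ne_iff]
  exact isOpen_ne_fun (hsh _).1 continuous_id

theorem ShiftCont.isOpen_snd_lt_s5 (hsh : ShiftCont t) (b : ℤ) :
    IsOpen {x : CZ0 | ∃ c d : ℤ, x = some (c, d) ∧ d < b} := by
  simp only [← CZ0mul_idem_right_ne_iff]
  exact isOpen_ne_fun (hsh _).2 continuous_id

theorem ShiftCont.isOpen_upper (hsh : ShiftCont t) (p : CZ) :
    IsOpen {x : CZ0 | CZ0le (some p) x} := by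
  obtain ⟨a, b⟩ := p
  have hA := hsh.isOpen_fst_lt_s5 (a + 1)
  have hB := hsh.isOpen_snd_lt_s5 (b + 1)
  convert (hA.inter hB).inter
    ((hB.preimage (hsh (some (a, a))).1).inter (hA.preimage (hsh (some (b, b))).2)) using 1
  ext x
  rcases x with _ | ⟨c, d⟩
  · simp [CZ0le]
  · simp only [CZ0le, CZle, CZ0mul, CZmul_eq_max, Set.mem_ofPred_eq, Set.mem_inter_iff,
      Set.mem_preimage, Option.some.injEq]
    constructor
    · rintro ⟨h, h'⟩
      exact ⟨⟨⟨c, d, rfl, by omega⟩, ⟨c, d, rfl, by omega⟩⟩,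
        ⟨_, _, rfl, by omega⟩, ⟨_, _, rfl, by omega⟩⟩
    · rintro ⟨⟨⟨_, _, h₁, h₁'⟩, ⟨_, _, h₂, h₂'⟩⟩, ⟨_, _, h₃, h₃'⟩, ⟨_, _, h₄, h₄'⟩⟩
      simp only [Prod.mk.injEq] at h₁ h₂ h₃ h₄
      omega

/-- Every nonzero element is isolated. -/
theorem ShiftCont.isOpen_singleton_some_s5 (hsh : ShiftCont t) (p : CZ) :
    IsOpen {(some p : CZ0)} := by
  obtain ⟨a, b⟩ := p
  convert (hsh.isOpen_upper (a, b)).sdiff (hsh.isClosed_upper (a - 1, b - 1)) using 1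
  ext x
  rcases x with _ | ⟨c, d⟩
  · simp [CZ0le]
  · simp only [CZ0le, CZle, Set.mem_singleton_iff, Set.mem_sdiff, Set.mem_ofPred_eq,
      Option.some.injEq, Prod.mk.injEq]
    omega

end ShiftContinuous

theorem stmt5 (t : TopologicalSpace CZ0) (h2 : @T2Space CZ0 t) (hnd : t ≠ ⊥)
    (hsh : ShiftCont t) :
    @IsClosed (CZ0 × CZ0) (@instTopologicalSpaceProd CZ0 CZ0 t t)
      {st : CZ0 × CZ0 | CZ0le st.1 st.2} := by
  rw [← isOpen_compl_iff]
  convert isOpen_iUnion fun p : CZ =>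
    (hsh.isOpen_singleton_some_s5 p).prod (hsh.isClosed_upper p).isOpen_compl using 1
  ext ⟨s, u⟩
  rcases s with _ | p <;> simp [CZ0le]
end

section
/- Let τ be a non-discrete Hausdorff shift-continuous topology on C_Z^0. Then for every nonzero element (a,b) of C_Z^0, the set ↑≼(a,b) is both open and closed in (C_Z^0, τ). -/
/-- `(n, n) · u = u` fails exactly for the nonzero `u = (a, b)` with `a < n`. -/
theorem idem_mul_ne_iff (n a b : ℤ) :
    CZ0mul (some (n, n)) (some (a, b)) ≠ some (a, b) ↔ a < n := by
  simp only [CZ0mul, CZmul, ne_eq, Option.some.injEq]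
  split_ifs <;> simp only [Prod.mk.injEq, and_true] <;> omega

/-- `u · (n, n) = u` fails exactly for the nonzero `u = (a, b)` with `b < n`. -/
theorem mul_idem_ne_iff (n a b : ℤ) :
    CZ0mul (some (a, b)) (some (n, n)) ≠ some (a, b) ↔ b < n := by
  simp only [CZ0mul, CZmul, ne_eq, Option.some.injEq]
  split_ifs <;> simp only [Prod.mk.injEq, true_and] <;> omega

/-- The nonzero elements `(a, b)` with `a ≤ n` and `b ≤ m`. -/
def lowerQuadrant (n m : ℤ) : Set CZ0 :=
  {u | CZ0mul (some (n + 1, n + 1)) u ≠ u} ∩ {u | CZ0mul u (some (m + 1, m + 1)) ≠ u}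

theorem none_notMem_lowerQuadrant (n m : ℤ) : none ∉ lowerQuadrant n m := by
  simp [lowerQuadrant, CZ0mul]

theorem some_mem_lowerQuadrant (n m a b : ℤ) :
    some (a, b) ∈ lowerQuadrant n m ↔ a ≤ n ∧ b ≤ m := by
  simp only [lowerQuadrant, Set.mem_inter_iff, Set.mem_ofPred_eq, idem_mul_ne_iff,
    mul_idem_ne_iff, Int.lt_add_one_iff]

theorem isOpen_lowerQuadrant [t : TopologicalSpace CZ0] [T2Space CZ0] (hsh : ShiftCont t)
    (n m : ℤ) : IsOpen (lowerQuadrant n m) :=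
  (isOpen_ne_fun (hsh _).1 continuous_id).inter (isOpen_ne_fun (hsh _).2 continuous_id)

/-- `↑≼(n, m)` is the fibre over `(n, m)` of the left shift by `(n, n)`. -/
theorem image_upSet_eq_preimage (n m : ℤ) :
    some '' upSet (n, m) = (fun u => CZ0mul (some (n, n)) u) ⁻¹' {some (n, m)} := by
  ext u
  rcases u with _ | ⟨a, b⟩
  · simp [CZ0mul]
  · simp only [Set.mem_image, Option.some.injEq, exists_eq_right, upSet, CZle, Set.mem_ofPred_eq,
      Set.mem_preimage, Set.mem_singleton_iff, CZ0mul, CZmul]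
    split_ifs <;> simp only [Prod.mk.injEq, true_and] <;> omega

theorem image_upSet_eq_inter (n m : ℤ) :
    some '' upSet (n, m) = lowerQuadrant n m ∩
      ((fun u => CZ0mul (some (n, n)) u) ⁻¹' lowerQuadrant n m ∩
        (fun u => CZ0mul u (some (m, m))) ⁻¹' lowerQuadrant n m) := by
  ext u
  rcases u with _ | ⟨a, b⟩
  · simp [none_notMem_lowerQuadrant]
  · simp only [Set.mem_image, Option.some.injEq, exists_eq_right, upSet, CZle, Set.mem_ofPred_eq,
      Set.mem_inter_iff, Set.mem_preimage, CZ0mul, CZmul]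
    split_ifs <;> simp only [some_mem_lowerQuadrant] <;> omega

theorem stmt6 (t : TopologicalSpace CZ0) (h2 : @T2Space CZ0 t) (hnd : t ≠ ⊥)
    (hsh : ShiftCont t) (ab : CZ) :
    @IsOpen CZ0 t (Option.some '' upSet ab) ∧ @IsClosed CZ0 t (Option.some '' upSet ab) := by
  obtain ⟨n, m⟩ := ab
  have hU := isOpen_lowerQuadrant hsh n m
  constructor
  · rw [image_upSet_eq_inter]
    exact hU.inter ((hU.preimage (hsh _).1).inter (hU.preimage (hsh _).2))
  · rw [image_upSet_eq_preimage]
    exact isClosed_singleton.preimage (hsh _).1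
end

section
/- Let τ be a non-discrete Hausdorff locally compact shift-continuous topology on C_Z^0. Then for every open neighbourhood U of the zero 0 in (C_Z^0, τ) there exists a neighbourhood V of 0 with V ⊆ U such that V is both compact and open in (C_Z^0, τ). -/
/-- In a countable locally compact Hausdorff space every open neighbourhood of a point contains a
compact open neighbourhood of that point. -/
theorem exists_isCompact_isOpen_subset_of_countable {X : Type*} [TopologicalSpace X] [Countable X]
    [T2Space X] [LocallyCompactSpace X] {x : X} {U : Set X} (hU : IsOpen U) (hx : x ∈ U) :
    ∃ V : Set X, x ∈ V ∧ V ⊆ U ∧ IsCompact V ∧ IsOpen V := by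
  obtain ⟨K, hK, hxK, hKU⟩ := exists_compact_subset hU hx
  have hbasis := CompletelyRegularSpace.isTopologicalBasis_clopens_of_cardinalMk_lt_continuum
    ((Cardinal.mk_le_aleph0 (α := X)).trans_lt Cardinal.aleph0_lt_continuum)
  obtain ⟨V, hV, hxV, hVK⟩ := hbasis.exists_subset_of_mem_open hxK isOpen_interior
  have hVK' : V ⊆ K := hVK.trans interior_subset
  exact ⟨V, hxV, hVK'.trans hKU, hK.of_isClosed_subset hV.isClosed hVK', hV.isOpen⟩

theorem stmt7 (t : TopologicalSpace CZ0) (h2 : @T2Space CZ0 t) (hnd : t ≠ ⊥)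
    (hlc : @LocallyCompactSpace CZ0 t) (hsh : ShiftCont t)
    (U : Set CZ0) (hU : @IsOpen CZ0 t U) (h0U : none ∈ U) :
    ∃ V : Set CZ0, none ∈ V ∧ V ⊆ U ∧ @IsCompact CZ0 t V ∧ @IsOpen CZ0 t V := by
  exact exists_isCompact_isOpen_subset_of_countable hU h0U
end

section
/- Let (x_n)_{n≥1} and (y_n)_{n≥1} be increasing sequences of positive integers with x_1 > 1, y_1 > 1, x_n + 1 < x_{n+1} and 2 < y_n + 1 < y_{n+1} for all n ≥ 1. Then (C_Z^0, τ_{{x_n}}^{{y_n}}) is a semitopological semigroup, i.e. the topology τ_{{x_n}}^{{y_n}} is shift-continuous: for every s ∈ C_Z^0 the maps x ↦ s·x and x ↦ x·s are continuous. -/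
/-- The set `D` from Example 2.7, for sequences `x, y : ℕ → ℤ`
(indexed from `0`, so `x 0` plays the role of `x₁`). -/
def Dset (x y : ℕ → ℤ) : Set CZ :=
  (upSet (0, 0) ∪ (⋃ i ∈ Set.Icc (1 : ℤ) (x 0 - 1), upSet (0, -i))
      ∪ (⋃ j ∈ Set.Icc (1 : ℤ) (y 0 - 1), upSet (-j, 0)))
    ∪ ⋃ k : ℕ, ((⋃ i ∈ Set.Icc (x k) (x (k + 1) - 1), upSet (-(x k), -i))
      ∪ (⋃ j ∈ Set.Icc (y k) (y (k + 1) - 1), upSet (-j, -(y k))))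

/-- The basic neighbourhood `U_{(a₁,b₁),…,(a_k,b_k)}` of zero: the complement in `C_Z^0`
of `D ∪ ↑≼(a₁,b₁) ∪ ⋯ ∪ ↑≼(a_k,b_k)`. -/
def UF (x y : ℕ → ℤ) (F : Finset CZ) : Set CZ0 :=
  (Option.some '' (Dset x y ∪ ⋃ ab ∈ F, upSet ab))ᶜ

/-- The topology `τ_{{x_n}}^{{y_n}}` on `C_Z^0`: all nonzero elements are isolated, and the
sets `U_{(a₁,b₁),…,(a_k,b_k)}` form a neighbourhood base at zero. -/
def tauXY (x y : ℕ → ℤ) : TopologicalSpace CZ0 :=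
  TopologicalSpace.generateFrom
    ({U | ∃ p : CZ, U = {some p}} ∪ {U | ∃ F : Finset CZ, U = UF x y F})

theorem mem_upSet {p q : CZ} : q ∈ upSet p ↔ p.1 - p.2 = q.1 - q.2 ∧ q.1 ≤ p.1 := Iff.rfl

theorem swap_mem_upSet {p q : CZ} (h : q ∈ upSet p) : q.swap ∈ upSet p.swap := by
  simp only [mem_upSet, Prod.fst_swap, Prod.snd_swap] at h ⊢
  omega

theorem swap_mem_Dset {x y : ℕ → ℤ} {p : CZ} (h : p ∈ Dset x y) : p.swap ∈ Dset y x := by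
  simp only [Dset, Set.mem_union, Set.mem_iUnion, exists_prop] at h ⊢
  rcases h with ((h | ⟨i, hi, h⟩) | ⟨i, hi, h⟩) | ⟨k, ⟨i, hi, h⟩ | ⟨i, hi, h⟩⟩
  · exact .inl (.inl (.inl (swap_mem_upSet h)))
  · exact .inl (.inr ⟨i, hi, swap_mem_upSet h⟩)
  · exact .inl (.inl (.inr ⟨i, hi, swap_mem_upSet h⟩))
  · exact .inr ⟨k, .inr ⟨i, hi, swap_mem_upSet h⟩⟩
  · exact .inr ⟨k, .inl ⟨i, hi, swap_mem_upSet h⟩⟩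

theorem natCast_lt_of_strictMono {x : ℕ → ℤ} (hx : StrictMono x) (h0 : 0 < x 0) (n : ℕ) :
    (n : ℤ) < x n := by
  induction n with
  | zero => simpa using h0
  | succ n ih =>
    have := hx (Nat.lt_add_one n)
    push_cast
    omega

/-- Only finitely many elements of `D` lie in a given right half-plane. -/
theorem finite_Dset_inter_fst_ge {x y : ℕ → ℤ} (hx : StrictMono x) (hx0 : 0 < x 0)
    (hypos : ∀ n, 0 < y n) (a : ℤ) : (Dset x y ∩ {p | a ≤ p.1}).Finite := by
  set M := x ((-a).toNat + 1)
  refine ((Set.finite_Icc a 0).prod (Set.finite_Icc (a - M) 0)).subset ?_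
  rintro ⟨p, q⟩ ⟨h, ha⟩
  have hM : x 0 ≤ M := hx.monotone (Nat.zero_le _)
  simp only [Set.mem_ofPred_eq] at ha
  simp only [Dset, Set.mem_union, Set.mem_iUnion, exists_prop, mem_upSet, Set.mem_Icc] at h
  simp only [Set.mem_prod, Set.mem_Icc]
  rcases h with ((h | ⟨i, hi, h⟩) | ⟨i, hi, h⟩) | ⟨k, ⟨i, hi, h⟩ | ⟨i, hi, h⟩⟩
  · omega
  · omega
  · omega
  · have hk := natCast_lt_of_strictMono hx hx0 k
    have hkM : x (k + 1) ≤ M := hx.monotone (by omega)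
    omega
  · have := hypos k
    omega

theorem finite_Dset_inter_snd_ge {x y : ℕ → ℤ} (hy : StrictMono y) (hy0 : 0 < y 0)
    (hxpos : ∀ n, 0 < x n) (b : ℤ) : (Dset x y ∩ {p | b ≤ p.2}).Finite :=
  ((finite_Dset_inter_fst_ge hy hy0 hxpos b).preimage Prod.swap_injective.injOn).subset
    fun _ h => ⟨swap_mem_Dset h.1, h.2⟩

theorem finite_upSet_inter_fst_ge (p : CZ) (a : ℤ) : (upSet p ∩ {q | a ≤ q.1}).Finite := by
  refine ((Set.finite_Icc a p.1).prod (Set.finite_Icc (a - p.1 + p.2) p.2)).subset ?_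
  rintro ⟨c, d⟩ ⟨h, ha⟩
  simp only [Set.mem_ofPred_eq] at ha
  simp only [mem_upSet] at h
  simp only [Set.mem_prod, Set.mem_Icc]
  omega

theorem finite_upSet_inter_snd_ge (p : CZ) (b : ℤ) : (upSet p ∩ {q | b ≤ q.2}).Finite :=
  ((finite_upSet_inter_fst_ge p.swap b).preimage Prod.swap_injective.injOn).subset
    fun _ h => ⟨swap_mem_upSet h.1, h.2⟩

theorem fst_le_CZmul_fst (s q : CZ) : s.1 ≤ (CZmul s q).1 := by
  unfold CZmul; split_ifs <;> simp only <;> omega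

theorem snd_le_CZmul_snd (s q : CZ) : s.2 ≤ (CZmul q s).2 := by
  unfold CZmul; split_ifs <;> simp only <;> omega

theorem mem_upSet_of_CZmul_left (s q : CZ) :
    q ∈ upSet ((CZmul s q).1 - (s.1 - s.2), (CZmul s q).2) := by
  rw [mem_upSet]; unfold CZmul; split_ifs <;> simp only <;> omega

theorem mem_upSet_of_CZmul_right (s q : CZ) :
    q ∈ upSet ((CZmul q s).1, (CZmul q s).2 - (s.2 - s.1)) := by
  rw [mem_upSet]; unfold CZmul; split_ifs <;> simp only <;> omega

theorem isOpen_tauXY_of_UF_subset {x y : ℕ → ℤ} {V : Set CZ0}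
    (hV : none ∈ V → ∃ F, UF x y F ⊆ V) : @IsOpen _ (tauXY x y) V := by
  let := tauXY x y
  rw [isOpen_iff_forall_mem_open]
  rintro (_ | p) hp
  · obtain ⟨F, hF⟩ := hV hp
    exact ⟨_, hF, TopologicalSpace.isOpen_generateFrom_of_mem (.inr ⟨F, rfl⟩), by simp [UF]⟩
  · exact ⟨_, Set.singleton_subset_iff.2 hp,
      TopologicalSpace.isOpen_generateFrom_of_mem (.inl ⟨p, rfl⟩), rfl⟩

/-- A zero-preserving extension of a self-map `f` of `C_Z` is continuous as soon as `f` takes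
only finitely many values in each complement of a basic neighbourhood of zero, and each fibre
of `f` is contained in some `↑≼(a,b)`. -/
theorem continuous_tauXY_map {x y : ℕ → ℤ} (f g : CZ → CZ)
    (hfin : ∀ F : Finset CZ, ((Dset x y ∪ ⋃ ab ∈ F, upSet ab) ∩ Set.range f).Finite)
    (hg : ∀ q, q ∈ upSet (g (f q))) :
    @Continuous _ _ (tauXY x y) (tauXY x y) (Option.map f) := by
  classical
  refine continuous_generateFrom_iff.2 ?_
  rintro _ (⟨p, rfl⟩ | ⟨F, rfl⟩) <;> refine isOpen_tauXY_of_UF_subset fun h => ?_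
  · simp at h
  · refine ⟨(hfin F).toFinset.image g, ?_⟩
    rintro (_ | q) hq
    · exact h
    · rintro ⟨r, hr, hrq⟩
      obtain rfl : r = f q := Option.some.inj hrq
      refine hq ⟨q, .inr ?_, rfl⟩
      refine Set.mem_biUnion (x := g (f q)) ?_ (hg q)
      exact Finset.mem_image_of_mem g ((hfin F).mem_toFinset.2 ⟨hr, q, rfl⟩)

theorem finite_Dset_union_upSets_inter {x y : ℕ → ℤ} {S : Set CZ} (hD : (Dset x y ∩ S).Finite)
    (hup : ∀ p, (upSet p ∩ S).Finite) (F : Finset CZ) :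
    ((Dset x y ∪ ⋃ ab ∈ F, upSet ab) ∩ S).Finite := by
  rw [Set.union_inter_distrib_right, Set.iUnion₂_inter]
  exact hD.union (F.finite_toSet.biUnion fun p _ => hup p)

theorem stmt13 (x y : ℕ → ℤ) (hxpos : ∀ n, 0 < x n) (hypos : ∀ n, 0 < y n)
    (hx0 : 1 < x 0) (hy0 : 1 < y 0)
    (hx : ∀ n, x n + 1 < x (n + 1)) (hy : ∀ n, 2 < y n + 1 ∧ y n + 1 < y (n + 1)) :
    ShiftCont (tauXY x y) := by
  have hxm : StrictMono x := strictMono_nat_of_lt_succ fun n => by linarith [hx n]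
  have hym : StrictMono y := strictMono_nat_of_lt_succ fun n => by linarith [(hy n).2]
  let := tauXY x y
  rintro (_ | s)
  · have hl : (fun u => CZ0mul none u) = fun _ => none := by
      funext u; cases u <;> rfl
    have hr : (fun u => CZ0mul u none) = fun _ => none := by
      funext u; cases u <;> rfl
    rw [hl, hr]
    exact ⟨continuous_const, continuous_const⟩
  · have hl : (fun u => CZ0mul (some s) u) = Option.map (CZmul s) := by
      funext u; cases u <;> rfl
    have hr : (fun u => CZ0mul u (some s)) = Option.map (CZmul · s) := by
      funext u; cases u <;> rfl
    rw [hl, hr]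
    constructor
    · refine continuous_tauXY_map _ (fun r => (r.1 - (s.1 - s.2), r.2)) (fun F => ?_)
        (mem_upSet_of_CZmul_left s)
      refine (finite_Dset_union_upSets_inter (finite_Dset_inter_fst_ge hxm (hxpos 0) hypos s.1)
        (finite_upSet_inter_fst_ge · s.1) F).subset (Set.inter_subset_inter_right _ ?_)
      exact Set.range_subset_iff.2 (fst_le_CZmul_fst s)
    · refine continuous_tauXY_map _ (fun r => (r.1, r.2 - (s.2 - s.1))) (fun F => ?_)
        (mem_upSet_of_CZmul_right s)
      refine (finite_Dset_union_upSets_inter (finite_Dset_inter_snd_ge hym (hypos 0) hxpos s.2)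
        (finite_upSet_inter_snd_ge · s.2) F).subset (Set.inter_subset_inter_right _ ?_)
      exact Set.range_subset_iff.2 (snd_le_CZmul_snd s)
end

section
/- The set of all Hausdorff locally compact shift-continuous topologies on the semigroup C_Z^0 has cardinality at least continuum (i.e. there exist at least 𝔠 = 2^{ℵ₀} pairwise distinct topologies τ on C_Z^0 such that (C_Z^0, τ) is a Hausdorff locally compact semitopological semigroup). -/
open Topology Set

section AdjoinedPoint

variable {α : Type*}

/-- The topology on `Option α` in which every `some p` is isolated and the neighbourhoods of `none`
are the sets containing `none` and all but finitely many points outside `B`. -/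
abbrev coneTopology (B : Set α) : TopologicalSpace (Option α) where
  IsOpen U := none ∈ U → {p | p ∉ B ∧ some p ∉ U}.Finite
  isOpen_univ := by simp
  isOpen_inter U V hU hV h := by
    refine ((hU h.1).union (hV h.2)).subset ?_
    rintro p ⟨hp, hn⟩
    by_cases hpU : some p ∈ U
    · exact Or.inr ⟨hp, fun hpV => hn ⟨hpU, hpV⟩⟩
    · exact Or.inl ⟨hp, hpU⟩
  isOpen_sUnion S hS := by
    rintro ⟨U, hU, hn⟩
    exact (hS U hU hn).subset fun p hp => ⟨hp.1, fun h => hp.2 ⟨U, hU, h⟩⟩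

theorem isOpen_coneTopology_of_none_notMem (B : Set α) {U : Set (Option α)} (h : none ∉ U) :
    IsOpen[coneTopology B] U :=
  fun h' => absurd h' h

theorem isOpen_coneTopology_compl_singleton (B : Set α) (p : α) :
    IsOpen[coneTopology B] ({some p}ᶜ : Set (Option α)) := fun _ =>
  (finite_singleton p).subset fun q hq => by simpa using hq.2

theorem t2Space_coneTopology (B : Set α) : @T2Space _ (coneTopology B) := by
  let _ := coneTopology B
  have separated (p : α) (y : Option α) (h : some p ≠ y) :
      ∃ u v : Set (Option α), IsOpen u ∧ IsOpen v ∧ some p ∈ u ∧ y ∈ v ∧ Disjoint u v :=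
    ⟨{some p}, {some p}ᶜ, isOpen_coneTopology_of_none_notMem B (by simp),
      isOpen_coneTopology_compl_singleton B p, rfl, h.symm, disjoint_compl_right⟩
  refine ⟨fun x y hxy => ?_⟩
  rcases x with _ | p
  · rcases y with _ | q
    · exact absurd rfl hxy
    · obtain ⟨u, v, hu, hv, hqu, hv', huv⟩ := separated q none hxy.symm
      exact ⟨v, u, hv, hu, hv', hqu, huv.symm⟩
  · exact separated p y hxy

theorem isOpen_coneTopology_cone (B : Set α) :
    IsOpen[coneTopology B] (insert none (some '' Bᶜ)) := fun _ =>
  finite_empty.subset fun p hp => hp.2 (Or.inr ⟨p, hp.1, rfl⟩)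

theorem isCompact_coneTopology_cone (B : Set α) :
    @IsCompact _ (coneTopology B) (insert none (some '' Bᶜ)) := by
  let _ := coneTopology B
  refine isCompact_of_finite_subcover fun {ι} U hU hcover => ?_
  obtain ⟨i, hi⟩ := mem_iUnion.1 (hcover (mem_insert none _))
  have hfin : (some '' {p | p ∉ B ∧ some p ∉ U i}).Finite := (hU i hi).image _
  have hsub : some '' {p | p ∉ B ∧ some p ∉ U i} ⊆ ⋃ j, U j := by
    rintro _ ⟨p, hp, rfl⟩
    exact hcover (Or.inr ⟨p, hp.1, rfl⟩)
  obtain ⟨t, ht⟩ := hfin.isCompact.elim_finite_subcover U hU hsub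
  classical
  refine ⟨insert i t, ?_⟩
  rw [Finset.set_biUnion_insert]
  rintro _ (rfl | ⟨p, hp, rfl⟩)
  · exact Or.inl hi
  · by_cases hpi : some p ∈ U i
    · exact Or.inl hpi
    · exact Or.inr (ht ⟨p, ⟨hp, hpi⟩, rfl⟩)

theorem locallyCompactSpace_coneTopology (B : Set α) :
    @LocallyCompactSpace _ (coneTopology B) := by
  let _ := coneTopology B
  have := t2Space_coneTopology B
  have : WeaklyLocallyCompactSpace (Option α) := by
    refine ⟨fun x => ?_⟩
    rcases x with _ | p
    · exact ⟨_, isCompact_coneTopology_cone B,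
        (isOpen_coneTopology_cone B).mem_nhds (mem_insert _ _)⟩
    · exact ⟨{some p}, isCompact_singleton,
        (isOpen_coneTopology_of_none_notMem B (by simp)).mem_nhds rfl⟩
  infer_instance

theorem continuous_coneTopology_map {B : Set α} {g : α → α} (hB : (B ∩ range g).Finite)
    (hg : ∀ q, {p | p ∉ B ∧ g p = q}.Finite) :
    @Continuous _ _ (coneTopology B) (coneTopology B) (Option.map g) := by
  let _ := coneTopology B
  refine continuous_def.2 fun U hU hn => ?_
  have hbad : ({q | q ∉ B ∧ some q ∉ U} ∪ B ∩ range g).Finite := (hU hn).union hB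
  refine (hbad.biUnion fun q _ => hg q).subset ?_
  rintro p ⟨hp, hpU⟩
  refine mem_biUnion (x := g p) ?_ ⟨hp, rfl⟩
  by_cases h : g p ∈ B
  · exact Or.inr ⟨h, p, rfl⟩
  · exact Or.inl ⟨h, hpU⟩

theorem finite_diff_of_coneTopology_eq {B C : Set α} (h : coneTopology B = coneTopology C) :
    (B \ C).Finite := by
  have hopen := isOpen_coneTopology_cone B
  rw [h] at hopen
  exact (hopen (mem_insert _ _)).subset fun p hp => ⟨hp.2, by simpa using hp.1⟩

end AdjoinedPoint

theorem shiftCont_coneTopology {B : Set CZ} (hfst : ∀ b, {p ∈ B | b ≤ p.1}.Finite)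
    (hsnd : ∀ b, {p ∈ B | b ≤ p.2}.Finite)
    (hdiag : ∀ b k, {p : CZ | p ∉ B ∧ p.1 ≤ b ∧ p.1 - p.2 = k}.Finite) :
    ShiftCont (coneTopology B) := by
  let _ := coneTopology B
  rintro (_ | ⟨a, b⟩)
  · have hleft : (fun u => CZ0mul none u) = fun _ => none := by
      funext u; cases u <;> rfl
    have hright : (fun u => CZ0mul u none) = fun _ => none := by
      funext u; cases u <;> rfl
    rw [hleft, hright]
    exact ⟨continuous_const, continuous_const⟩
  · have hleft : (fun u => CZ0mul (some (a, b)) u) = Option.map (CZmul (a, b)) := by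
      funext u; cases u <;> rfl
    have hright : (fun u => CZ0mul u (some (a, b))) = Option.map (CZmul · (a, b)) := by
      funext u; cases u <;> rfl
    rw [hleft, hright]
    constructor
    · refine continuous_coneTopology_map ((hfst a).subset ?_) fun q => ?_
      · rintro _ ⟨hp, ⟨c, d⟩, rfl⟩
        refine ⟨hp, ?_⟩
        simp only [CZmul]
        split_ifs <;> dsimp only <;> omega
      · refine ((finite_singleton (q.1 - a + b, q.2)).union (hdiag b (b - q.2))).subset ?_
        rintro ⟨c, d⟩ ⟨hp, rfl⟩
        simp only [CZmul, mem_union, mem_singleton_iff, mem_ofPred_eq, Prod.mk.injEq]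
        split_ifs <;> dsimp only
        · left; omega
        · right; exact ⟨hp, by omega, by omega⟩
        · right; exact ⟨hp, by omega, by omega⟩
    · refine continuous_coneTopology_map ((hsnd b).subset ?_) fun q => ?_
      · rintro _ ⟨hp, ⟨c, d⟩, rfl⟩
        refine ⟨hp, ?_⟩
        simp only [CZmul]
        split_ifs <;> dsimp only <;> omega
      · refine ((finite_singleton (q.1, q.2 - b + a)).union (hdiag q.1 (q.1 - a))).subset ?_
        rintro ⟨c, d⟩ ⟨hp, rfl⟩
        simp only [CZmul, mem_union, mem_singleton_iff, mem_ofPred_eq, Prod.mk.injEq]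
        split_ifs <;> dsimp only
        · right; exact ⟨hp, by omega, by omega⟩
        · left; omega
        · left; omega

/-- A sector around the negative diagonal, together with the points `(-n, -3n)` for which the first
component of `n` under the pairing function lies in `x`. -/
def sector (x : Set ℕ) : Set CZ :=
  {p | p.1 ≤ 0 ∧ p.2 ≤ 0 ∧ (2 * p.1 ≤ p.2 ∧ 2 * p.2 ≤ p.1 ∨
    p.2 = 3 * p.1 ∧ (Nat.unpair p.1.natAbs).1 ∈ x)}

theorem shiftCont_coneTopology_sector (x : Set ℕ) : ShiftCont (coneTopology (sector x)) := by
  refine shiftCont_coneTopology (fun b => ?_) (fun b => ?_) (fun b k => ?_)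
  · refine (finite_Icc ((3 * b, 3 * b) : CZ) (0, 0)).subset ?_
    rintro ⟨c, d⟩ ⟨⟨hc, hd, h⟩, hb⟩
    simp only [mem_Icc, Prod.mk_le_mk] at *
    omega
  · refine (finite_Icc ((3 * b, 3 * b) : CZ) (0, 0)).subset ?_
    rintro ⟨c, d⟩ ⟨⟨hc, hd, h⟩, hb⟩
    simp only [mem_Icc, Prod.mk_le_mk] at *
    omega
  · refine (finite_Icc ((-2 * |k|, -2 * |k| - k) : CZ) (b, b - k)).subset ?_
    rintro ⟨c, d⟩ ⟨hp, hb, hk⟩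
    have hc : -2 * |k| ≤ c := by
      by_contra hlt
      refine hp ?_
      simp only [sector, mem_ofPred_eq] at *
      have := neg_abs_le k
      have := le_abs_self k
      exact ⟨by omega, by omega, Or.inl (by omega)⟩
    simp only [mem_Icc, Prod.mk_le_mk] at *
    omega

theorem sector_diff_infinite {x y : Set ℕ} {k : ℕ} (hx : k ∈ x) (hy : k ∉ y) :
    (sector x \ sector y).Infinite := by
  refine infinite_of_injective_forall_mem
    (f := fun j : ℕ => ((-(Nat.pair k (j + 1) : ℤ), -3 * (Nat.pair k (j + 1) : ℤ)) : CZ)) ?_ ?_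
  · intro i j hij
    have h : Nat.pair k (i + 1) = Nat.pair k (j + 1) := by
      have := congrArg Prod.fst hij
      dsimp only at this
      omega
    have := (Nat.pair_eq_pair.1 h).2
    omega
  · intro j
    have := Nat.right_le_pair k (j + 1)
    constructor
    · refine ⟨?_, ?_, Or.inr ⟨?_, ?_⟩⟩
      · dsimp only; omega
      · dsimp only; omega
      · dsimp only; omega
      · simpa using hx
    · rintro ⟨-, -, h | h⟩
      · dsimp only at h; omega
      · exact hy (by simpa using h.2)

theorem injective_coneTopology_sector :
    Function.Injective fun x : Set ℕ => coneTopology (sector x) := by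
  have le_of_eq {x y : Set ℕ} (h : coneTopology (sector x) = coneTopology (sector y)) : x ⊆ y :=
    fun k hx => by_contra fun hy =>
      sector_diff_infinite hx hy (finite_diff_of_coneTopology_eq h)
  exact fun x y h => (le_of_eq h).antisymm (le_of_eq h.symm)

theorem stmt15 :
    ∃ T : Set (TopologicalSpace CZ0),
      Cardinal.continuum ≤ Cardinal.mk T ∧
      ∀ t ∈ T, @T2Space CZ0 t ∧ @LocallyCompactSpace CZ0 t ∧ ShiftCont t := by
  refine ⟨range fun x : Set ℕ => coneTopology (sector x), ?_, ?_⟩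
  · rw [Cardinal.mk_range_eq _ injective_coneTopology_sector, Cardinal.mk_set, Cardinal.mk_nat,
      Cardinal.two_power_aleph0]
  · rintro _ ⟨x, rfl⟩
    exact ⟨t2Space_coneTopology _, locallyCompactSpace_coneTopology _,
      shiftCont_coneTopology_sector x⟩
end

section
/- (C_Z^0, τ_min^sh) is a Hausdorff semitopological semigroup (for every s ∈ C_Z^0 the maps x ↦ s·x and x ↦ x·s are continuous) on which the inversion map (a,b) ↦ (b,a), 0 ↦ 0 is continuous. -/
/-- The basic neighbourhood `U^↑_{(a₁,b₁),…,(a_k,b_k)}` of zero: the complement in `C_Z^0`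
of `↑≼(a₁,b₁) ∪ ⋯ ∪ ↑≼(a_k,b_k)`. -/
def UpF (F : Finset CZ) : Set CZ0 :=
  (Option.some '' ⋃ ab ∈ F, upSet ab)ᶜ

/-- The topology `τ_min^sh` on `C_Z^0`: all nonzero elements are isolated, and the sets
`U^↑_{(a₁,b₁),…,(a_k,b_k)}` form a neighbourhood base at zero. -/
def tauMinSh : TopologicalSpace CZ0 :=
  TopologicalSpace.generateFrom
    ({U | ∃ p : CZ, U = {some p}} ∪ {U | ∃ F : Finset CZ, U = UpF F})

open scoped Topology

theorem none_mem_UpF (F : Finset CZ) : none ∈ UpF F := by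
  simp [UpF]

theorem some_mem_UpF {F : Finset CZ} {p : CZ} :
    some p ∈ UpF F ↔ ∀ q ∈ F, ¬ CZle q p := by
  simp [UpF, upSet]

theorem isOpen_tauMinSh_singleton_some (p : CZ) : IsOpen[tauMinSh] {some p} :=
  TopologicalSpace.isOpen_generateFrom_of_mem (Or.inl ⟨p, rfl⟩)

theorem isOpen_tauMinSh_UpF (F : Finset CZ) : IsOpen[tauMinSh] (UpF F) :=
  TopologicalSpace.isOpen_generateFrom_of_mem (Or.inr ⟨F, rfl⟩)

/-- A set is open in `τ_min^sh` as soon as it contains a basic neighbourhood of zero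
whenever it contains zero. -/
theorem isOpen_tauMinSh_of_UpF_subset {U : Set CZ0}
    (h : none ∈ U → ∃ F : Finset CZ, UpF F ⊆ U) : IsOpen[tauMinSh] U := by
  let _ : TopologicalSpace CZ0 := tauMinSh
  refine isOpen_iff_forall_mem_open.2 fun x hx => ?_
  cases x with
  | none =>
    obtain ⟨F, hF⟩ := h hx
    exact ⟨UpF F, hF, isOpen_tauMinSh_UpF F, none_mem_UpF F⟩
  | some p =>
    exact ⟨{some p}, Set.singleton_subset_iff.2 hx, isOpen_tauMinSh_singleton_some p, rfl⟩

/-- A self-map of `C_Z` extends by `0 ↦ 0` to a continuous map of `C_Z^0` if the preimage of every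
principal upper set is contained in a principal upper set. -/
theorem continuous_tauMinSh_map {f : CZ → CZ} (hf : ∀ q, ∃ r, ∀ u, CZle q (f u) → CZle r u) :
    @Continuous CZ0 CZ0 tauMinSh tauMinSh (Option.map f) := by
  refine continuous_generateFrom_iff.2 ?_
  rintro _ (⟨p, rfl⟩ | ⟨F, rfl⟩) <;> refine isOpen_tauMinSh_of_UpF_subset fun h => ?_
  · simp at h
  · choose g hg using hf
    refine ⟨F.image g, fun x hx => ?_⟩
    cases x with
    | none => exact h
    | some u =>
      exact some_mem_UpF.2 fun q hq hle =>
        some_mem_UpF.1 hx (g q) (Finset.mem_image_of_mem g hq) (hg q u hle)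

theorem exists_CZle_of_CZle_mul_left (p q : CZ) : ∃ r, ∀ u, CZle q (CZmul p u) → CZle r u := by
  refine ⟨(max p.2 (q.1 - p.1 + p.2),
    max p.2 (q.1 - p.1 + p.2) - (q.1 - q.2 - (p.1 - p.2))), fun u => ?_⟩
  unfold CZle CZmul
  split_ifs <;> dsimp only <;> omega

theorem exists_CZle_of_CZle_mul_right (p q : CZ) : ∃ r, ∀ u, CZle q (CZmul u p) → CZle r u := by
  refine ⟨(max q.1 (p.1 + (q.1 - q.2 - (p.1 - p.2))),
    max q.1 (p.1 + (q.1 - q.2 - (p.1 - p.2))) - (q.1 - q.2 - (p.1 - p.2))), fun u => ?_⟩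
  unfold CZle CZmul
  split_ifs <;> dsimp only <;> omega

theorem t2Space_tauMinSh : @T2Space CZ0 tauMinSh := by
  let _ : TopologicalSpace CZ0 := tauMinSh
  have separate_zero (p : CZ) : Disjoint (UpF {p}) {some p} := by
    simp [some_mem_UpF, CZle]
  refine ⟨fun x y hxy => ?_⟩
  cases x with
  | none =>
    cases y with
    | none => exact absurd rfl hxy
    | some p =>
      exact ⟨_, _, isOpen_tauMinSh_UpF {p}, isOpen_tauMinSh_singleton_some p,
        none_mem_UpF _, rfl, separate_zero p⟩
  | some p =>
    cases y with
    | none =>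
      exact ⟨_, _, isOpen_tauMinSh_singleton_some p, isOpen_tauMinSh_UpF {p},
        rfl, none_mem_UpF _, (separate_zero p).symm⟩
    | some q =>
      exact ⟨_, _, isOpen_tauMinSh_singleton_some p, isOpen_tauMinSh_singleton_some q,
        rfl, rfl, Set.disjoint_singleton.2 hxy⟩

theorem shiftCont_tauMinSh : ShiftCont tauMinSh := by
  let _ : TopologicalSpace CZ0 := tauMinSh
  intro s
  cases s with
  | none =>
    have hl : (fun u => CZ0mul none u) = fun _ => none := by
      funext u; cases u <;> rfl
    have hr : (fun u => CZ0mul u none) = fun _ => none := by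
      funext u; cases u <;> rfl
    rw [hl, hr]
    exact ⟨continuous_const, continuous_const⟩
  | some p =>
    have hl : (fun u => CZ0mul (some p) u) = Option.map (fun u => CZmul p u) := by
      funext u; cases u <;> rfl
    have hr : (fun u => CZ0mul u (some p)) = Option.map (fun u => CZmul u p) := by
      funext u; cases u <;> rfl
    rw [hl, hr]
    exact ⟨continuous_tauMinSh_map (exists_CZle_of_CZle_mul_left p),
      continuous_tauMinSh_map (exists_CZle_of_CZle_mul_right p)⟩

theorem stmt17 :
    @T2Space CZ0 tauMinSh ∧ ShiftCont tauMinSh ∧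
    @Continuous CZ0 CZ0 tauMinSh tauMinSh (Option.map Prod.swap) := by
  refine ⟨t2Space_tauMinSh, shiftCont_tauMinSh,
    continuous_tauMinSh_map fun q => ⟨q.swap, fun u => ?_⟩⟩
  simp only [CZle, Prod.fst_swap, Prod.snd_swap]
  omega
end

section
/- (C_Z^0, τ_min^i) is a minimal topological inverse semigroup: the multiplication C_Z^0 × C_Z^0 → C_Z^0 is jointly continuous and the inversion (a,b) ↦ (b,a), 0 ↦ 0 is continuous with respect to τ_min^i, the topology τ_min^i is Hausdorff, and moreover every Hausdorff topology τ on C_Z^0 with τ ⊆ τ_min^i for which multiplication is jointly continuous and inversion is continuous satisfies τ = τ_min^i. -/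
/-- The basic neighbourhood `S^{→a} ∩ S^{b↑}` of zero. -/
def Vab (a b : ℤ) : Set CZ0 :=
  insert none (Option.some '' {p : CZ | a ≤ p.1 ∧ b ≤ p.2})

/-- The topology `τ_min^i` on `C_Z^0`: all nonzero elements are isolated, and the sets
`S^{→a} ∩ S^{b↑}` (`a, b ∈ ℤ`) form a neighbourhood base at zero. -/
def tauMinI : TopologicalSpace CZ0 :=
  TopologicalSpace.generateFrom
    ({U | ∃ p : CZ, U = {some p}} ∪ {U | ∃ a b : ℤ, U = Vab a b})

theorem isOpen_tauMinI_some (p : CZ) : @IsOpen CZ0 tauMinI {some p} :=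
  TopologicalSpace.isOpen_generateFrom_of_mem (Or.inl ⟨p, rfl⟩)

theorem isOpen_tauMinI_Vab (a b : ℤ) : @IsOpen CZ0 tauMinI (Vab a b) :=
  TopologicalSpace.isOpen_generateFrom_of_mem (Or.inr ⟨a, b, rfl⟩)

@[simp]
theorem none_mem_Vab (a b : ℤ) : none ∈ Vab a b := by simp [Vab]

@[simp]
theorem some_mem_Vab (a b : ℤ) (p : CZ) : some p ∈ Vab a b ↔ a ≤ p.1 ∧ b ≤ p.2 := by
  simp [Vab]

theorem isOpen_tauMinI_of_none_notMem {U : Set CZ0} (hU : none ∉ U) : @IsOpen CZ0 tauMinI U := by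
  let := tauMinI
  refine isOpen_iff_forall_mem_open.2 fun u hu => ?_
  rcases u with _ | p
  · exact absurd hu hU
  · exact ⟨{some p}, by simpa using hu, isOpen_tauMinI_some p, rfl⟩

theorem t2Space_tauMinI : @T2Space CZ0 tauMinI := by
  let := tauMinI
  have separate (p : CZ) : Disjoint {some p} (Vab (p.1 + 1) (p.2 + 1)) := by simp
  refine ⟨fun u v huv => ?_⟩
  rcases u with _ | p <;> rcases v with _ | q
  · exact absurd rfl huv
  · exact ⟨_, _, isOpen_tauMinI_Vab _ _, isOpen_tauMinI_some q,
      none_mem_Vab _ _, Set.mem_singleton _, (separate q).symm⟩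
  · exact ⟨_, _, isOpen_tauMinI_some p, isOpen_tauMinI_Vab _ _, Set.mem_singleton _,
      none_mem_Vab _ _, separate p⟩
  · exact ⟨_, _, isOpen_tauMinI_some p, isOpen_tauMinI_some q, Set.mem_singleton _,
      Set.mem_singleton _, by simpa using huv⟩

theorem continuous_inv_tauMinI :
    @Continuous CZ0 CZ0 tauMinI tauMinI (Option.map Prod.swap) := by
  let := tauMinI
  refine continuous_generateFrom_iff.2 ?_
  rintro _ (⟨p, rfl⟩ | ⟨a, b, rfl⟩)
  · exact isOpen_tauMinI_of_none_notMem (by simp)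
  · have : Option.map Prod.swap ⁻¹' Vab a b = Vab b a := by
      ext (_ | p) <;> simp [and_comm]
    rw [this]
    exact isOpen_tauMinI_Vab b a

theorem CZ0mul_mem_Vab {a b : ℤ} {s t : CZ0} (hs : s ∈ Vab a b) (ht : t ∈ Vab a b) :
    CZ0mul s t ∈ Vab a b := by
  rcases s with _ | p <;> rcases t with _ | q <;>
    simp only [CZ0mul, none_mem_Vab, some_mem_Vab, CZmul] at *
  grind

theorem CZ0mul_some_left_mem_Vab {a b : ℤ} (p : CZ) {t : CZ0}
    (ht : t ∈ Vab (max p.2 (a - p.1 + p.2)) b) : CZ0mul (some p) t ∈ Vab a b := by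
  rcases t with _ | q <;> simp only [CZ0mul, none_mem_Vab, some_mem_Vab, CZmul] at *
  grind

theorem CZ0mul_some_right_mem_Vab {a b : ℤ} (q : CZ) {s : CZ0}
    (hs : s ∈ Vab a (max q.1 (b - q.2 + q.1))) : CZ0mul s (some q) ∈ Vab a b := by
  rcases s with _ | p <;> simp only [CZ0mul, none_mem_Vab, some_mem_Vab, CZmul] at *
  grind

theorem continuous_CZ0mul_tauMinI :
    @Continuous (CZ0 × CZ0) CZ0 (@instTopologicalSpaceProd CZ0 CZ0 tauMinI tauMinI) tauMinI
      (fun st => CZ0mul st.1 st.2) := by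
  let := tauMinI
  refine continuous_generateFrom_iff.2 fun U hU => isOpen_prod_iff.2 fun s t hst => ?_
  rcases s with _ | p <;> rcases t with _ | q
  rotate_right
  · refine ⟨_, _, isOpen_tauMinI_some p, isOpen_tauMinI_some q, Set.mem_singleton _,
      Set.mem_singleton _, ?_⟩
    rintro ⟨_, _⟩ ⟨rfl, rfl⟩
    exact hst
  all_goals
    obtain ⟨p, rfl⟩ | ⟨a, b, rfl⟩ := hU
    · simp [CZ0mul] at hst
  · exact ⟨_, _, isOpen_tauMinI_Vab a b, isOpen_tauMinI_Vab a b, none_mem_Vab _ _,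
      none_mem_Vab _ _, fun st h => CZ0mul_mem_Vab h.1 h.2⟩
  · refine ⟨_, _, isOpen_tauMinI_Vab a (max q.1 (b - q.2 + q.1)), isOpen_tauMinI_some q,
      none_mem_Vab _ _, Set.mem_singleton _, ?_⟩
    rintro ⟨s, _⟩ ⟨hs, rfl⟩
    exact CZ0mul_some_right_mem_Vab q hs
  · refine ⟨_, _, isOpen_tauMinI_some p, isOpen_tauMinI_Vab (max p.2 (a - p.1 + p.2)) b,
      Set.mem_singleton _, none_mem_Vab _ _, ?_⟩
    rintro ⟨_, t⟩ ⟨rfl, ht⟩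
    exact CZ0mul_some_left_mem_Vab p ht

section InverseSemigroupTopology

variable [TopologicalSpace CZ0] [T2Space CZ0]

theorem isOpen_Vab_of_continuous (hmul : Continuous fun st : CZ0 × CZ0 => CZ0mul st.1 st.2)
    (hinv : Continuous (Option.map Prod.swap : CZ0 → CZ0)) (a b : ℤ) : IsOpen (Vab a b) := by
  -- `(a-1,a-1) · u · u⁻¹` equals `(a-1,a-1)` exactly when `u` is nonzero with first coordinate
  -- less than `a`, and dually for `u⁻¹ · u`.
  have hleft : Continuous fun u : CZ0 =>
      CZ0mul (some (a - 1, a - 1)) (CZ0mul u (u.map Prod.swap)) :=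
    hmul.comp (continuous_const.prodMk (hmul.comp (continuous_id.prodMk hinv)))
  have hright : Continuous fun u : CZ0 =>
      CZ0mul (some (b - 1, b - 1)) (CZ0mul (u.map Prod.swap) u) :=
    hmul.comp (continuous_const.prodMk (hmul.comp (hinv.prodMk continuous_id)))
  convert (isOpen_ne_fun hleft (continuous_const (y := some (a - 1, a - 1)))).inter
    (isOpen_ne_fun hright (continuous_const (y := some (b - 1, b - 1)))) using 1
  ext (_ | ⟨x, y⟩)
  · simp [CZ0mul]
  · simp only [some_mem_Vab, CZ0mul, CZmul, Option.map_some, Prod.swap, Set.mem_inter_iff,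
      Set.mem_ofPred_eq, ne_eq, Option.some.injEq]
    grind

theorem isOpen_singleton_some_of_continuous
    (hmul : Continuous fun st : CZ0 × CZ0 => CZ0mul st.1 st.2)
    (hinv : Continuous (Option.map Prod.swap : CZ0 → CZ0)) (p : CZ) :
    IsOpen ({some p} : Set CZ0) := by
  obtain ⟨a, b⟩ := p
  have hleft : Continuous fun u : CZ0 => CZ0mul (some (a + 1, a + 1)) u :=
    hmul.comp (continuous_const.prodMk continuous_id)
  have hright : Continuous fun u : CZ0 => CZ0mul u (some (b + 1, b + 1)) :=
    hmul.comp (continuous_id.prodMk continuous_const)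
  convert (isOpen_Vab_of_continuous hmul hinv a b).inter
    ((isOpen_ne_fun hleft continuous_id).inter (isOpen_ne_fun hright continuous_id)) using 1
  ext (_ | ⟨x, y⟩)
  · simp [CZ0mul]
  · simp only [some_mem_Vab, CZ0mul, CZmul, Set.mem_inter_iff, Set.mem_singleton_iff,
      Set.mem_ofPred_eq, ne_eq, Option.some.injEq, id_eq]
    grind

end InverseSemigroupTopology

theorem stmt19 :
    @T2Space CZ0 tauMinI ∧
    @Continuous (CZ0 × CZ0) CZ0 (@instTopologicalSpaceProd CZ0 CZ0 tauMinI tauMinI) tauMinI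
      (fun st => CZ0mul st.1 st.2) ∧
    @Continuous CZ0 CZ0 tauMinI tauMinI (Option.map Prod.swap) ∧
    (∀ t : TopologicalSpace CZ0, @T2Space CZ0 t → tauMinI ≤ t →
      @Continuous (CZ0 × CZ0) CZ0 (@instTopologicalSpaceProd CZ0 CZ0 t t) t
        (fun st => CZ0mul st.1 st.2) →
      @Continuous CZ0 CZ0 t t (Option.map Prod.swap) → t = tauMinI) := by
  refine ⟨t2Space_tauMinI, continuous_CZ0mul_tauMinI, continuous_inv_tauMinI,
    fun t ht hle hmul hinv => le_antisymm (le_generateFrom ?_) hle⟩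
  rintro _ (⟨p, rfl⟩ | ⟨a, b, rfl⟩)
  · exact isOpen_singleton_some_of_continuous hmul hinv p
  · exact isOpen_Vab_of_continuous hmul hinv a b
end
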